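/- Let (C_i)_{i∈ℤ₊} be finite-length abelian categories and F_{i-1,i}: C_i → C_{i-1} shortening functors. Then the restricted inverse limit C = lim_restr C_i is a Serre subcategory of lim C_i (closed under subobjects, quotients and extensions), every object of C has finite length, and for every object C = ({C_i},{φ_{i-1,i}}) of C one has ℓ_C(C) ≤ max{ ℓ_{C_i}(C_i) : i ≥ 0 }. -/

import Mathlib

open CategoryTheory Limits

universe v u v₁ u₁ v₂ u₂

namespace InvLim

variable {C : ℕ → Type u} [∀ i, Category.{v} (C i)]

/-- An object of the inverse limit category: a family of objects `obj i ∈ C i` together with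
isomorphisms `φ_{i,i+1} : F i (obj (i+1)) ≅ obj i`. -/
structure Obj (F : ∀ i : ℕ, C (i + 1) ⥤ C i) where
  obj : ∀ i, C i
  iso : ∀ i, (F i).obj (obj (i + 1)) ≅ obj i

variable (F : ∀ i : ℕ, C (i + 1) ⥤ C i)

/-- A morphism in the inverse limit category: a family of componentwise morphisms compatible
with the structure isomorphisms. -/
@[ext]
structure Hom (X Y : Obj F) where
  hom : ∀ i, X.obj i ⟶ Y.obj i
  comm : ∀ i, (F i).map (hom (i + 1)) ≫ (Y.iso i).hom = (X.iso i).hom ≫ hom i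

/-- The inverse limit category `lim C_i`. -/
instance : Category (Obj F) where
  Hom X Y := Hom F X Y
  id X := ⟨fun _ => 𝟙 _, fun i => by simp⟩
  comp f g := ⟨fun i => f.hom i ≫ g.hom i, fun i => by
    rw [Functor.map_comp, Category.assoc, g.comm, ← Category.assoc, f.comm, Category.assoc]⟩
  id_comp f := by apply Hom.ext; funext i; exact Category.id_comp _
  comp_id f := by apply Hom.ext; funext i; exact Category.comp_id _
  assoc f g h := by apply Hom.ext; funext i; exact Category.assoc _ _ _

/-- The componentwise morphisms of a morphism in the inverse limit category. -/
def homApp {X Y : Obj F} (f : X ⟶ Y) (i : ℕ) : X.obj i ⟶ Y.obj i :=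
  Hom.hom f i

/-- The projection functor `Pr i : lim C_j ⥤ C i`. -/
def Pr (i : ℕ) : Obj F ⥤ C i where
  obj X := X.obj i
  map f := Hom.hom f i
  map_id _ := rfl
  map_comp _ _ := rfl



/-- `X` admits a Jordan–Hölder filtration with `n` simple subquotients, i.e. `ℓ(X) = n`. -/
def HasLength {A : Type u₁} [Category.{v₁} A] [Abelian A] (X : A) (n : ℕ) : Prop :=
  ∃ s : Fin (n + 1) → Subobject X, Monotone s ∧ s 0 = ⊥ ∧ s (Fin.last n) = ⊤ ∧
    ∀ i : Fin n, ∃ h : s i.castSucc ≤ s i.succ,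
      Simple (cokernel (Subobject.ofLE _ _ h))

/-- A finite-length category: every object admits a Jordan–Hölder filtration. -/
def FiniteLength (A : Type u₁) [Category.{v₁} A] [Abelian A] : Prop :=
  ∀ X : A, ∃ n, HasLength X n

/-- An object is simple or zero. -/
def SimpleOrZero (A : Type u₁) [Category.{v₁} A] [Limits.HasZeroMorphisms A] (X : A) : Prop :=
  Simple X ∨ Limits.IsZero X

/-- An exact functor between finite-length abelian categories is shortening if it does not
increase lengths. -/
def Shortening {A : Type u₁} {B : Type u₂} [Category.{v₁} A] [Abelian A]
    [Category.{v₂} B] [Abelian B] (G : A ⥤ B) : Prop :=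
  ∀ (X : A) (n m : ℕ), HasLength X n → HasLength (G.obj X) m → m ≤ n

variable {C : ℕ → Type u} [∀ i, Category.{v} (C i)] [∀ i, Abelian (C i)]

/-- The objects of the restricted inverse limit: those whose sequence of component lengths is
bounded. -/
def RestrP (F : ∀ i : ℕ, C (i + 1) ⥤ C i) (X : InvLim.Obj F) : Prop :=
  ∃ N : ℕ, ∀ (i : ℕ) (n : ℕ), HasLength (X.obj i) n → n ≤ N



end InvLim


namespace InvLim

section Limits

variable {C : ℕ → Type u} [∀ i, Category.{v} (C i)] {F : ∀ i : ℕ, C (i + 1) ⥤ C i}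

@[ext]
theorem hom_ext_Pr {X Y : Obj F} {f g : X ⟶ Y} (h : ∀ i, (Pr F i).map f = (Pr F i).map g) :
    f = g :=
  Hom.ext (funext h)

/-- The structure isomorphisms, in terms of the projection functors. -/
def str (X : Obj F) (i : ℕ) : (F i).obj ((Pr F (i + 1)).obj X) ≅ (Pr F i).obj X :=
  X.iso i

theorem Pr_comm {X Y : Obj F} (f : X ⟶ Y) (i : ℕ) :
    (F i).map ((Pr F (i + 1)).map f) ≫ (str Y i).hom = (str X i).hom ≫ (Pr F i).map f :=
  Hom.comm f i

theorem Pr_comm_assoc {X Y : Obj F} (f : X ⟶ Y) (i : ℕ) {Z : C i} (h : (Pr F i).obj Y ⟶ Z) :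
    (F i).map ((Pr F (i + 1)).map f) ≫ (str Y i).hom ≫ h =
      (str X i).hom ≫ (Pr F i).map f ≫ h := by
  rw [← Category.assoc, Pr_comm, Category.assoc]

/-- The structure isomorphisms, as a natural isomorphism between projection functors. -/
def prIso (F : ∀ i : ℕ, C (i + 1) ⥤ C i) (i : ℕ) : Pr F (i + 1) ⋙ F i ≅ Pr F i :=
  NatIso.ofComponents (fun X => str X i) (fun f => Pr_comm f i)

/-- Constructor for morphisms, in terms of the projection functors. -/
def mkHom {X Y : Obj F} (f : ∀ i, (Pr F i).obj X ⟶ (Pr F i).obj Y)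
    (h : ∀ i, (F i).map (f (i + 1)) ≫ (str Y i).hom = (str X i).hom ≫ f i) : X ⟶ Y :=
  (⟨f, h⟩ : Hom F X Y)

theorem isIso_of_isIso_Pr {X Y : Obj F} (f : X ⟶ Y) (hf : ∀ i, IsIso ((Pr F i).map f)) :
    IsIso f := by
  refine ⟨mkHom (fun i => inv ((Pr F i).map f)) fun i => ?_, ?_, ?_⟩
  · rw [Functor.map_inv, IsIso.inv_comp_eq, Pr_comm_assoc, IsIso.hom_inv_id, Category.comp_id]
  · ext i
    exact IsIso.hom_inv_id ((Pr F i).map f)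
  · ext i
    exact IsIso.inv_hom_id ((Pr F i).map f)

theorem isIso_Pr_of_le {X Y : Obj F} (f : X ⟶ Y) {i j : ℕ} (hij : i ≤ j)
    (h : IsIso ((Pr F j).map f)) : IsIso ((Pr F i).map f) := by
  induction j, hij using Nat.le_induction with
  | base => exact h
  | succ j _ ih =>
    exact ih ((NatIso.isIso_map_iff (prIso F j) f).1
      (inferInstanceAs (IsIso ((F j).map ((Pr F (j + 1)).map f)))))

theorem comm_comp_of_comp_eq {X Y Z : Obj F} (l : ∀ i, (Pr F i).obj X ⟶ (Pr F i).obj Y)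
    (p : Y ⟶ Z) (q : X ⟶ Z) (h : ∀ i, l i ≫ (Pr F i).map p = (Pr F i).map q) (i : ℕ) :
    ((F i).map (l (i + 1)) ≫ (str Y i).hom) ≫ (Pr F i).map p =
      ((str X i).hom ≫ l i) ≫ (Pr F i).map p := by
  rw [Category.assoc, Category.assoc, ← Pr_comm, ← Functor.map_comp_assoc, h, h, Pr_comm]

theorem comp_comm_of_comp_eq {X Y Z : Obj F} (l : ∀ i, (Pr F i).obj Y ⟶ (Pr F i).obj Z)
    (p : X ⟶ Y) (q : X ⟶ Z) (h : ∀ i, (Pr F i).map p ≫ l i = (Pr F i).map q) (i : ℕ) :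
    (F i).map ((Pr F (i + 1)).map p) ≫ (F i).map (l (i + 1)) ≫ (str Z i).hom =
      (F i).map ((Pr F (i + 1)).map p) ≫ (str Y i).hom ≫ l i := by
  rw [← Functor.map_comp_assoc, h, Pr_comm_assoc, h, Pr_comm]

section

variable {J : Type} [SmallCategory J] {K : J ⥤ Obj F}

/-- A cone in the inverse limit category is a limit cone if all its components are. -/
def isLimitOfPr (c : Cone K) (t : ∀ i, IsLimit ((Pr F i).mapCone c)) : IsLimit c where
  lift s := mkHom (fun i => (t i).lift ((Pr F i).mapCone s)) fun i => (t i).hom_ext fun j =>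
    comm_comp_of_comp_eq _ (c.π.app j) (s.π.app j)
      (fun i => (t i).fac ((Pr F i).mapCone s) j) i
  fac s j := by
    ext i
    exact (t i).fac ((Pr F i).mapCone s) j
  uniq s m hm := by
    ext i
    exact (t i).uniq ((Pr F i).mapCone s) _ fun j => congrArg (Pr F i).map (hm j)

/-- A cocone in the inverse limit category is a colimit cocone if all its components are. -/
noncomputable def isColimitOfPr [∀ i, PreservesColimitsOfShape J (F i)] (c : Cocone K)
    (t : ∀ i, IsColimit ((Pr F i).mapCocone c)) : IsColimit c where
  desc s := mkHom (fun i => (t i).desc ((Pr F i).mapCocone s)) fun i =>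
    (isColimitOfPreserves (F i) (t (i + 1))).hom_ext fun j =>
      comp_comm_of_comp_eq _ (c.ι.app j) (s.ι.app j)
        (fun i => (t i).fac ((Pr F i).mapCocone s) j) i
  fac s j := by
    ext i
    exact (t i).fac ((Pr F i).mapCocone s) j
  uniq s m hm := by
    ext i
    exact (t i).uniq ((Pr F i).mapCocone s) _ fun j => congrArg (Pr F i).map (hm j)

/-- The componentwise limit cone. -/
noncomputable def limitCone (K : J ⥤ Obj F) [∀ i, HasLimitsOfShape J (C i)]
    [∀ i, PreservesLimitsOfShape J (F i)] : Cone K where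
  pt :=
    { obj := fun i => limit (K ⋙ Pr F i)
      iso := fun i => preservesLimitIso (F i) (K ⋙ Pr F (i + 1)) ≪≫
        HasLimit.isoOfNatIso (Functor.isoWhiskerLeft K (prIso F i)) }
  π :=
    { app := fun j => mkHom (fun i => limit.π (K ⋙ Pr F i) j) fun i => Eq.symm <|
        (Category.assoc _ _ _).trans <|
        (congrArg _ (HasLimit.isoOfNatIso_hom_π
          (Functor.isoWhiskerLeft K (prIso F i)) j)).trans <|
        preservesLimitIso_hom_π_assoc (F i) (K ⋙ Pr F (i + 1)) j _
      naturality := fun j j' f => by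
        ext i
        exact (Category.id_comp _).trans (limit.w (K ⋙ Pr F i) f).symm }

/-- The componentwise colimit cocone. -/
noncomputable def colimitCocone (K : J ⥤ Obj F) [∀ i, HasColimitsOfShape J (C i)]
    [∀ i, PreservesColimitsOfShape J (F i)] : Cocone K where
  pt :=
    { obj := fun i => colimit (K ⋙ Pr F i)
      iso := fun i => preservesColimitIso (F i) (K ⋙ Pr F (i + 1)) ≪≫
        HasColimit.isoOfNatIso (Functor.isoWhiskerLeft K (prIso F i)) }
  ι :=
    { app := fun j => mkHom (fun i => colimit.ι (K ⋙ Pr F i) j) fun i =>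
        (ι_preservesColimitIso_hom_assoc (F i) (K ⋙ Pr F (i + 1)) j _).trans <|
        HasColimit.isoOfNatIso_ι_hom (Functor.isoWhiskerLeft K (prIso F i)) j
      naturality := fun j j' f => by
        ext i
        exact (colimit.w (K ⋙ Pr F i) f).trans (Category.comp_id _).symm }

/-- The components of the componentwise limit cone are limit cones. -/
noncomputable def isLimitMapLimitCone (K : J ⥤ Obj F) [∀ i, HasLimitsOfShape J (C i)]
    [∀ i, PreservesLimitsOfShape J (F i)] (i : ℕ) : IsLimit ((Pr F i).mapCone (limitCone K)) :=
  limit.isLimit (K ⋙ Pr F i)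

/-- The components of the componentwise colimit cocone are colimit cocones. -/
noncomputable def isColimitMapColimitCocone (K : J ⥤ Obj F) [∀ i, HasColimitsOfShape J (C i)]
    [∀ i, PreservesColimitsOfShape J (F i)] (i : ℕ) :
    IsColimit ((Pr F i).mapCocone (colimitCocone K)) :=
  colimit.isColimit (K ⋙ Pr F i)

end

instance [∀ i, HasFiniteLimits (C i)] [∀ i, PreservesFiniteLimits (F i)] :
    HasFiniteLimits (Obj F) where
  out _ _ _ := ⟨fun K => ⟨⟨⟨limitCone K, isLimitOfPr _ (isLimitMapLimitCone K)⟩⟩⟩⟩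

instance [∀ i, HasFiniteColimits (C i)] [∀ i, PreservesFiniteColimits (F i)] :
    HasFiniteColimits (Obj F) where
  out _ _ _ :=
    ⟨fun K => ⟨⟨⟨colimitCocone K, isColimitOfPr _ (isColimitMapColimitCocone K)⟩⟩⟩⟩

instance [∀ i, HasFiniteLimits (C i)] [∀ i, PreservesFiniteLimits (F i)] (i : ℕ) :
    PreservesFiniteLimits (Pr F i) where
  preservesFiniteLimits _ _ _ := ⟨fun {K} =>
    preservesLimit_of_preserves_limit_cone (isLimitOfPr _ (isLimitMapLimitCone K))
      (isLimitMapLimitCone K i)⟩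

instance [∀ i, HasFiniteColimits (C i)] [∀ i, PreservesFiniteColimits (F i)] (i : ℕ) :
    PreservesFiniteColimits (Pr F i) where
  preservesFiniteColimits _ _ _ := ⟨fun {K} =>
    preservesColimit_of_preserves_colimit_cocone (isColimitOfPr _ (isColimitMapColimitCocone K))
      (isColimitMapColimitCocone K i)⟩

end Limits

section Abelian

variable {C : ℕ → Type u} [∀ i, Category.{v} (C i)] [∀ i, Abelian (C i)]
  {F : ∀ i : ℕ, C (i + 1) ⥤ C i} [∀ i, (F i).Additive]

instance (X Y : Obj F) : Zero (X ⟶ Y) where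
  zero := mkHom (fun _ => 0) fun i => by simp

instance (X Y : Obj F) : Add (X ⟶ Y) where
  add f g := mkHom (fun i => (Pr F i).map f + (Pr F i).map g) fun i => by
    rw [Functor.map_add, Preadditive.add_comp, Preadditive.comp_add, Pr_comm, Pr_comm]

instance (X Y : Obj F) : Neg (X ⟶ Y) where
  neg f := mkHom (fun i => -(Pr F i).map f) fun i => by
    rw [Functor.map_neg, Preadditive.neg_comp, Preadditive.comp_neg, Pr_comm]

instance (X Y : Obj F) : AddCommGroup (X ⟶ Y) where
  add_assoc f g h := by ext i; exact add_assoc ((Pr F i).map f) _ _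
  zero_add f := by ext i; exact zero_add ((Pr F i).map f)
  add_zero f := by ext i; exact add_zero ((Pr F i).map f)
  neg_add_cancel f := by ext i; exact neg_add_cancel ((Pr F i).map f)
  add_comm f g := by ext i; exact add_comm ((Pr F i).map f) _
  nsmul := nsmulRec
  zsmul := zsmulRec

instance : Preadditive (Obj F) where
  add_comp X Y Z f f' g := by
    ext i
    exact Preadditive.add_comp _ _ _ ((Pr F i).map f) ((Pr F i).map f') ((Pr F i).map g)
  comp_add X Y Z f g g' := by
    ext i
    exact Preadditive.comp_add _ _ _ ((Pr F i).map f) ((Pr F i).map g) ((Pr F i).map g')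

instance (i : ℕ) : (Pr F i).Additive where
  map_add := rfl

variable [∀ i, PreservesFiniteLimits (F i)] [∀ i, PreservesFiniteColimits (F i)]

instance {X Y : Obj F} (f : X ⟶ Y) : IsIso (Abelian.coimageImageComparison f) :=
  isIso_of_isIso_Pr _ fun i =>
    ((MorphismProperty.isomorphisms (C i)).arrow_mk_iso_iff
      (Abelian.PreservesCoimageImageComparison.iso (Pr F i) f)).2
      (inferInstanceAs (IsIso (Abelian.coimageImageComparison ((Pr F i).map f))))

/-- The inverse limit of abelian categories along exact functors is abelian. -/
noncomputable abbrev abelianObj : Abelian (Obj F) :=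
  Abelian.ofCoimageImageComparisonIsIso

end Abelian

end InvLim

namespace InvLim

section Length

open Subobject

variable {A : Type u₁} [Category.{v₁} A] [Abelian A]

theorem le_of_factors_epi_comp {X W : A} {U V : Subobject X} (e : W ⟶ V) [Epi e]
    (h : U.Factors (e ≫ V.arrow)) : V ≤ U := by
  have sq : CommSq (U.factorThru _ h) e U.arrow V.arrow := ⟨by simp⟩
  have := strongEpi_of_epi e
  exact le_of_comm sq.lift sq.fac_right

theorem le_of_factors_sub {X W : A} {U V : Subobject X} (e : W ⟶ V) [Epi e] (x : W ⟶ U)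
    (h : U.Factors (e ≫ V.arrow - x ≫ U.arrow)) : V ≤ U := by
  refine le_of_factors_epi_comp e ?_
  simpa using factors_add _ _ h (factors_comp_arrow x)

theorem factors_sub_comp_arrow {X W : A} {U V : Subobject X} (hUV : U ≤ V) (e : W ⟶ V)
    (x : W ⟶ U) : V.Factors (e ≫ V.arrow - x ≫ U.arrow) :=
  (factors_iff _ _).2 ⟨e - x ≫ ofLE U V hUV, by simp⟩

/-- Let `T / S` be simple. A subobject `U ≤ T` not contained in `S` contains every `V ≤ T` above it
whose intersection with `S` it contains. -/
theorem le_of_simple_of_inf_le {X : A} {S T U V : Subobject X} (hST : S ≤ T)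
    [Simple (cokernel (ofLE S T hST))] (hV : V ≤ T) (hUV : U ≤ V) (hU : ¬ U ≤ S)
    (hVS : V ⊓ S ≤ U) : V ≤ U := by
  have hne : ofLE U T (hUV.trans hV) ≫ cokernel.π (ofLE S T hST) ≠ 0 := fun h => hU <|
    le_of_comm (Abelian.monoLift (ofLE S T hST) _ h) <| by
      rw [← ofLE_arrow hST, Abelian.monoLift_comp_assoc, ofLE_arrow]
  have := epi_of_nonzero_to_simple hne
  obtain ⟨W, e, _, x, hx⟩ := (epi_iff_surjective_up_to_refinements _).1 this
    (ofLE V T hV ≫ cokernel.π (ofLE S T hST))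
  have h₀ : (e ≫ ofLE V T hV - x ≫ ofLE U T (hUV.trans hV)) ≫ cokernel.π (ofLE S T hST) = 0 := by
    simp [hx]
  refine le_of_factors_sub e x (factors_of_le _ hVS ((inf_factors _).2
    ⟨factors_sub_comp_arrow hUV e x, (factors_iff _ _).2 ⟨Abelian.monoLift (ofLE S T hST) _ h₀, ?_⟩⟩))
  change Abelian.monoLift (ofLE S T hST) _ h₀ ≫ S.arrow = _
  rw [← ofLE_arrow hST, Abelian.monoLift_comp_assoc]
  simp

theorem pullback_factors_iff {X Y W : A} (f : X ⟶ Y) (P : Subobject Y) (k : W ⟶ X) :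
    ((Subobject.pullback f).obj P).Factors k ↔ P.Factors (k ≫ f) := by
  have sq := isPullback f P
  constructor
  · intro h
    refine (factors_iff _ _).2 ⟨factorThru _ _ h ≫ pullbackπ f P, ?_⟩
    change (factorThru _ _ h ≫ pullbackπ f P) ≫ P.arrow = _
    rw [Category.assoc, sq.w, factorThru_arrow_assoc]
  · intro h
    exact (factors_iff _ _).2
      ⟨sq.lift (factorThru _ _ h) k (factorThru_arrow _ _ h), sq.lift_snd _ _ _⟩

/-- In a short exact sequence, a subobject of the middle term is determined, among comparable ones,
by its trace on the left term and its image in the right term. -/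
theorem le_of_pullback_le_of_image_le {S : ShortComplex A} (hS : S.ShortExact)
    {U V : Subobject S.X₂} (hUV : U ≤ V)
    (h₁ : (Subobject.pullback S.f).obj V ≤ (Subobject.pullback S.f).obj U)
    (h₃ : imageSubobject (V.arrow ≫ S.g) ≤ imageSubobject (U.arrow ≫ S.g)) : V ≤ U := by
  have := hS.mono_f
  obtain ⟨W, e, _, x, hx⟩ := (epi_iff_surjective_up_to_refinements
    (factorThruImageSubobject (U.arrow ≫ S.g))).1 inferInstance
    (factorThruImageSubobject (V.arrow ≫ S.g) ≫ ofLE _ _ h₃)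
  have h₀ : (e ≫ V.arrow - x ≫ U.arrow) ≫ S.g = 0 := by
    have := congrArg (· ≫ (imageSubobject (U.arrow ≫ S.g)).arrow) hx
    simp only [Category.assoc, ofLE_arrow, imageSubobject_arrow_comp] at this
    simp [this]
  have hk := hS.exact.lift_f _ h₀
  refine le_of_factors_sub e x ?_
  rw [← hk, ← pullback_factors_iff]
  refine factors_of_le _ h₁ ?_
  rw [pullback_factors_iff, hk]
  exact factors_sub_comp_arrow hUV e x

theorem pullback_obj_strictMono {X Y : A} (g : X ⟶ Y) [Epi g] :
    StrictMono (Subobject.pullback g).obj := by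
  intro U V hUV
  refine ((Subobject.pullback g).monotone hUV.le).lt_of_not_ge fun h => hUV.not_ge ?_
  obtain ⟨W, e, _, x, hx⟩ := (epi_iff_surjective_up_to_refinements g).1 inferInstance V.arrow
  refine le_of_factors_epi_comp e ?_
  rw [hx, ← pullback_factors_iff]
  refine factors_of_le _ h ?_
  rw [pullback_factors_iff, ← hx]
  exact factors_comp_arrow e

theorem HasLength.exists_strictMono {X : A} {n : ℕ} (h : HasLength X n) :
    ∃ s : Fin (n + 1) → Subobject X, StrictMono s := by
  obtain ⟨s, -, -, -, hs⟩ := h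
  refine ⟨s, Fin.strictMono_iff_lt_succ.2 fun i => ?_⟩
  obtain ⟨hle, hsimple⟩ := hs i
  refine hle.lt_of_not_ge fun hge => Simple.not_isZero (cokernel (ofLE _ _ hle)) ?_
  have : IsIso (ofLE _ _ hle) := ⟨ofLE _ _ hge, by simp, by simp⟩
  exact isZero_cokernel_of_epi _

open Classical in
theorem HasLength.exists_strictMono_nat {X : A} {n : ℕ} (h : HasLength X n) :
    ∃ r : Subobject X → ℕ, StrictMono r ∧ ∀ U, r U ≤ n := by
  obtain ⟨s, -, hs₀, hsn, hs⟩ := h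
  let I (U : Subobject X) : Finset (Fin n) := {i | ¬ U ⊓ s i.succ ≤ s i.castSucc}
  refine ⟨fun U => (I U).card, fun U V hUV => Finset.card_lt_card ?_,
    fun U => (Finset.card_le_univ _).trans_eq (Fintype.card_fin n)⟩
  refine ⟨fun i hi => ?_, fun hVU => hUV.not_ge ?_⟩
  · simp only [I, Finset.mem_filter_univ] at hi ⊢
    exact fun h => hi ((inf_le_inf_right _ hUV.le).trans h)
  have key (i : Fin (n + 1)) : V ⊓ s i ≤ U := by
    induction i using Fin.induction with
    | zero => simp [hs₀]
    | succ i ih =>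
      obtain ⟨hle, _⟩ := hs i
      by_cases hi : i ∈ I V
      · have hiU := hVU hi
        simp only [I, Finset.mem_filter_univ] at hiU
        refine (le_of_simple_of_inf_le hle inf_le_right (inf_le_inf_right _ hUV.le) hiU ?_).trans
          inf_le_left
        exact le_inf ((inf_le_inf_right _ inf_le_left).trans ih) (inf_le_left.trans inf_le_right)
      · simp only [I, Finset.mem_filter_univ, not_not] at hi
        exact (le_inf inf_le_left hi).trans ih
  simpa [hsn] using key (Fin.last n)

theorem le_of_strictMono_of_strictMono {α : Type*} [Preorder α] {n m : ℕ} {s : Fin (n + 1) → α}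
    (hs : StrictMono s) {r : α → ℕ} (hr : StrictMono r) (hm : ∀ a, r a ≤ m) : n ≤ m := by
  have := Fintype.card_le_of_injective (fun i => (⟨r (s i), Nat.lt_succ_of_le (hm _)⟩ : Fin (m + 1)))
    (fun i j hij => (hr.comp hs).injective (Fin.ext_iff.1 hij))
  simpa using this

/-- The length bounds the number of steps of any chain of subobjects. -/
theorem HasLength.le_of_strictMono {X : A} {n m : ℕ} (h : HasLength X m)
    {s : Fin (n + 1) → Subobject X} (hs : StrictMono s) : n ≤ m := by
  obtain ⟨r, hr, hm⟩ := h.exists_strictMono_nat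
  exact le_of_strictMono_of_strictMono hs hr hm

theorem simple_cokernel_of_covBy {X : A} {S T : Subobject X} (h : S ⋖ T) :
    Simple (cokernel (ofLE S T h.le)) where
  mono_isIso_iff_nonzero {Y} f _ := by
    constructor
    · rintro _ rfl
      have h₀ : cokernel.π (ofLE S T h.le) = 0 := by
        rw [← cancel_mono (inv (0 : Y ⟶ cokernel (ofLE S T h.le))),
          ← cancel_mono (0 : Y ⟶ cokernel (ofLE S T h.le))]
        simp
      refine h.lt.not_ge (le_of_comm (Abelian.monoLift (ofLE S T h.le) (𝟙 _) (by simp [h₀])) ?_)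
      nth_rw 1 [← ofLE_arrow h.le]
      rw [Abelian.monoLift_comp_assoc, Category.id_comp]
    · intro hf
      let p := pullback.fst (cokernel.π (ofLE S T h.le)) f
      let q := pullback.snd (cokernel.π (ofLE S T h.le)) f
      have w : p ≫ cokernel.π (ofLE S T h.le) = q ≫ f := pullback.condition
      have : Epi q := inferInstanceAs (Epi (pullback.snd _ _))
      let D : Subobject X := Subobject.mk (p ≫ T.arrow)
      have hSD : S ≤ D := le_mk_of_comm (pullback.lift (ofLE S T h.le) 0 (by simp))
        (by rw [pullback.lift_fst_assoc, ofLE_arrow])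
      have hDT : D ≤ T := mk_le_of_comm p rfl
      rcases h.eq_or_eq hSD hDT with hD | hD
      · exfalso
        apply hf
        have hp : p = ofMkLE (p ≫ T.arrow) S hD.le ≫ ofLE S T h.le := by
          rw [← cancel_mono T.arrow]
          simp
        rw [← cancel_epi q, ← w, hp, Category.assoc, cokernel.condition, comp_zero, comp_zero]
      · have hp : ofLEMk T (p ≫ T.arrow) hD.ge ≫ p = 𝟙 _ := by
          rw [← cancel_mono T.arrow]
          simp
        have : Epi f := by
          refine epi_of_epi_fac (f := ofLEMk T (p ≫ T.arrow) hD.ge ≫ q)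
            (h := cokernel.π (ofLE S T h.le)) ?_
          rw [Category.assoc, ← w, reassoc_of% hp]
        exact isIso_of_mono_of_epi f

theorem finiteDimensionalOrder_of_bounded {α : Type*} [Preorder α] {N : ℕ}
    (hN : ∀ (n : ℕ) (s : Fin (n + 1) → α), StrictMono s → n ≤ N) [Nonempty α] :
    FiniteDimensionalOrder α := by
  rw [← not_infiniteDimensionalOrder_iff]
  intro h
  let p := LTSeries.withLength α (N + 1)
  have hp : p.length = N + 1 := LTSeries.length_withLength α _
  exact (hN p.length p p.strictMono).not_gt (hp ▸ Nat.lt_succ_self N)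

/-- An object whose chains of subobjects have bounded length has a Jordan–Hölder filtration. -/
theorem exists_hasLength_of_bounded {X : A} {N : ℕ}
    (hN : ∀ (n : ℕ) (s : Fin (n + 1) → Subobject X), StrictMono s → n ≤ N) :
    ∃ n, HasLength X n := by
  have := finiteDimensionalOrder_of_bounded hN
  have : WellFoundedLT (Subobject X) :=
    ⟨SetRel.IsWellFounded.of_finiteDimensional {(a, b) : Subobject X × Subobject X | a < b}⟩
  have : WellFoundedGT (Subobject X) :=
    ⟨SetRel.IsWellFounded.inv_of_finiteDimensional {(a, b) : Subobject X × Subobject X | a < b}⟩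
  obtain ⟨a, h₀, n, hn, h⟩ := exists_covBy_seq_of_wellFoundedLT_wellFoundedGT (Subobject X)
  refine ⟨n, fun i => a i, Fin.monotone_iff_le_succ.2 fun i => (h i i.2).le, h₀.eq_bot, hn.eq_top,
    fun i => ⟨(h i i.2).le, simple_cokernel_of_covBy (h i i.2)⟩⟩

section ShortExact

variable {S : ShortComplex A} {n₁ n₂ n₃ : ℕ}

theorem HasLength.le_of_shortExact_left (hS : S.ShortExact)
    (h₁ : HasLength S.X₁ n₁) (h₂ : HasLength S.X₂ n₂) :
    n₁ ≤ n₂ := by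
  have := hS.mono_f
  obtain ⟨s, hs⟩ := h₁.exists_strictMono
  refine h₂.le_of_strictMono (s := (Subobject.map S.f).obj ∘ s) (StrictMono.comp ?_ hs)
  exact (Subobject.map S.f).monotone.strictMono_of_injective
    (Function.LeftInverse.injective (g := (Subobject.pullback S.f).obj) (pullback_map_self S.f))

theorem HasLength.le_of_shortExact_right (hS : S.ShortExact)
    (h₂ : HasLength S.X₂ n₂) (h₃ : HasLength S.X₃ n₃) :
    n₃ ≤ n₂ := by
  have := hS.epi_g
  obtain ⟨s, hs⟩ := h₃.exists_strictMono
  exact h₂.le_of_strictMono ((pullback_obj_strictMono S.g).comp hs)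

theorem HasLength.le_add_of_shortExact (hS : S.ShortExact)
    (h₁ : HasLength S.X₁ n₁) (h₂ : HasLength S.X₂ n₂)
    (h₃ : HasLength S.X₃ n₃) : n₂ ≤ n₁ + n₃ := by
  obtain ⟨s, hs⟩ := h₂.exists_strictMono
  obtain ⟨r₁, hr₁, hn₁⟩ := h₁.exists_strictMono_nat
  obtain ⟨r₃, hr₃, hn₃⟩ := h₃.exists_strictMono_nat
  let α (U : Subobject S.X₂) := (Subobject.pullback S.f).obj U
  let β (U : Subobject S.X₂) := imageSubobject (U.arrow ≫ S.g)
  refine le_of_strictMono_of_strictMono hs (r := fun U => r₁ (α U) + r₃ (β U)) (fun U V hUV => ?_)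
    fun U => add_le_add (hn₁ _) (hn₃ _)
  have hα : α U ≤ α V := (Subobject.pullback S.f).monotone hUV.le
  have hβ : β U ≤ β V := by
    have := imageSubobject_comp_le (ofLE U V hUV.le) (V.arrow ≫ S.g)
    simpa only [ofLE_arrow_assoc] using this
  by_cases h : α V ≤ α U
  · exact add_lt_add_of_le_of_lt (hr₁.monotone hα) (hr₃ (hβ.lt_of_not_ge fun h' =>
      hUV.not_ge (le_of_pullback_le_of_image_le hS hUV.le h h')))
  · exact add_lt_add_of_lt_of_le (hr₁ (hα.lt_of_not_ge h)) (hr₃.monotone hβ)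

end ShortExact

end Length

section InverseLimit

variable {C : ℕ → Type u} [∀ i, Category.{v} (C i)] [∀ i, Abelian (C i)]
  {F : ∀ i : ℕ, C (i + 1) ⥤ C i} [∀ i, PreservesFiniteLimits (F i)]

/-- The component of a subobject in the inverse limit category. -/
noncomputable def subobjectPr {X : Obj F} (i : ℕ) (U : Subobject X) :
    Subobject ((Pr F i).obj X) :=
  Subobject.mk ((Pr F i).map U.arrow)

theorem subobjectPr_le {X : Obj F} (i : ℕ) {U V : Subobject X} (h : U ≤ V) :
    subobjectPr i U ≤ subobjectPr i V :=
  Subobject.mk_le_mk_of_comm ((Pr F i).map (Subobject.ofLE U V h))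
    (by rw [← Functor.map_comp, Subobject.ofLE_arrow])

theorem isIso_Pr_ofLE {X : Obj F} (i : ℕ) {U V : Subobject X} (h : U ≤ V)
    (h' : subobjectPr i V ≤ subobjectPr i U) :
    IsIso ((Pr F i).map (Subobject.ofLE U V h)) := by
  unfold subobjectPr at h'
  refine ⟨Subobject.ofMkLEMk _ _ h', ?_, ?_⟩
  · rw [← cancel_mono ((Pr F i).map U.arrow), Category.assoc, Subobject.ofMkLEMk_comp,
      ← Functor.map_comp, Subobject.ofLE_arrow, Category.id_comp]
  · rw [← cancel_mono ((Pr F i).map V.arrow), Category.assoc, ← Functor.map_comp,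
      Subobject.ofLE_arrow, Subobject.ofMkLEMk_comp, Category.id_comp]

theorem exists_subobjectPr_lt {X : Obj F} {U V : Subobject X} (h : U < V) :
    ∃ i, ∀ j, i ≤ j → subobjectPr j U < subobjectPr j V := by
  by_contra! hc
  refine h.not_ge ?_
  have : IsIso (Subobject.ofLE U V h.le) := isIso_of_isIso_Pr _ fun i => by
    obtain ⟨j, hij, hj⟩ := hc i
    refine isIso_Pr_of_le _ hij (isIso_Pr_ofLE j h.le ?_)
    by_contra hn
    exact hj ((subobjectPr_le j h.le).lt_of_not_ge hn)
  exact Subobject.le_of_comm (inv (Subobject.ofLE U V h.le)) (by simp)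

/-- A strict chain of subobjects in the inverse limit stays strict in some component. -/
theorem exists_strictMono_subobjectPr {X : Obj F} {n : ℕ} {s : Fin (n + 1) → Subobject X}
    (hs : StrictMono s) : ∃ i, StrictMono (fun k => subobjectPr i (s k)) := by
  choose i hi using fun k : Fin n => exists_subobjectPr_lt (hs (Fin.castSucc_lt_succ (i := k)))
  exact ⟨Finset.univ.sup i, Fin.strictMono_iff_lt_succ.2 fun k =>
    hi k _ (Finset.le_sup (Finset.mem_univ k))⟩

end InverseLimit

end InvLim

open CategoryTheory Limits InvLim in
/-- The restricted inverse limit of finite-length categories along shortening functors is a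
Serre subcategory of `lim C_i` (closed under subobjects, quotients and extensions, i.e. for any
short exact sequence the middle term lies in it iff the outer terms do), every object of it has
finite length, and `ℓ(C) ≤ max_i ℓ(C_i)`. -/
theorem stmt_9 {C : ℕ → Type u} [∀ i, Category.{v} (C i)] [∀ i, Abelian (C i)]
    (hfl : ∀ i, FiniteLength (C i)) (F : ∀ i : ℕ, C (i + 1) ⥤ C i)
    [∀ i, PreservesFiniteLimits (F i)] [∀ i, PreservesFiniteColimits (F i)]
    (hshort : ∀ i, Shortening (F i)) :
    ∃ Ab : Abelian (InvLim.Obj F), letI := Ab;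
      (∀ S : ShortComplex (InvLim.Obj F), S.ShortExact →
        (RestrP F S.X₂ ↔ RestrP F S.X₁ ∧ RestrP F S.X₃)) ∧
      (∀ X : InvLim.Obj F, RestrP F X →
        ∃ n : ℕ, HasLength X n ∧
          ∀ N : ℕ, (∀ i m : ℕ, HasLength (X.obj i) m → m ≤ N) → n ≤ N) := by
  have (i : ℕ) : (F i).Additive := Functor.additive_of_preserves_binary_products _
  refine ⟨abelianObj, fun S hS => ?_, fun X hX => ?_⟩
  · let : Abelian (InvLim.Obj F) := abelianObj
    have hSi (i : ℕ) : (S.map (Pr F i)).ShortExact := hS.map_of_exact (Pr F i)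
    constructor
    · rintro ⟨N, hN⟩
      refine ⟨⟨N, fun i n hn => ?_⟩, ⟨N, fun i n hn => ?_⟩⟩
      · obtain ⟨m, hm⟩ := hfl i (S.X₂.obj i)
        exact (HasLength.le_of_shortExact_left (hSi i) hn hm).trans (hN i m hm)
      · obtain ⟨m, hm⟩ := hfl i (S.X₂.obj i)
        exact (HasLength.le_of_shortExact_right (hSi i) hm hn).trans (hN i m hm)
    · rintro ⟨⟨N₁, hN₁⟩, ⟨N₃, hN₃⟩⟩
      refine ⟨N₁ + N₃, fun i n hn => ?_⟩
      obtain ⟨m₁, hm₁⟩ := hfl i (S.X₁.obj i)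
      obtain ⟨m₃, hm₃⟩ := hfl i (S.X₃.obj i)
      exact (HasLength.le_add_of_shortExact (hSi i) hm₁ hn hm₃).trans
        (add_le_add (hN₁ i m₁ hm₁) (hN₃ i m₃ hm₃))
  · let : Abelian (InvLim.Obj F) := abelianObj
    have bound (N : ℕ) (hN : ∀ i m : ℕ, HasLength (X.obj i) m → m ≤ N) (n : ℕ)
        (s : Fin (n + 1) → Subobject X) (hs : StrictMono s) : n ≤ N := by
      obtain ⟨i, hi⟩ := exists_strictMono_subobjectPr hs
      obtain ⟨m, hm⟩ := hfl i (X.obj i)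
      exact (HasLength.le_of_strictMono hm hi).trans (hN i m hm)
    obtain ⟨N, hN⟩ := hX
    obtain ⟨n, hn⟩ := exists_hasLength_of_bounded (bound N hN)
    obtain ⟨s, hs⟩ := hn.exists_strictMono
    exact ⟨n, hn, fun N' hN' => bound N' hN' n s hs⟩
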